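/- arXiv:2409.15734 — 2 statements merged into one kernel-verified Lean document; each statement's English description precedes it below -/
import Mathlib

section
/- Suppose Pred ≤ −(κ_fcd/2)·τ̄⁺·Δ², τ̄⁺ > 0, and (1−η)·κ_fcd·τ̄⁺ ≥ (4·κ_f + 2·Υ₂)·Δ. Then Pred < 0 and Ared ≤ η·Pred (equivalently Ared/Pred ≥ η), where Ared = f̄_s − f̄_k + μ·(‖c(x+s+d)‖ − ‖c(x)‖) is the actual reduction computed at the corrected trial point x+s+d. -/
open scoped RealInnerProductSpace NNReal
open ContinuousLinearMap

noncomputable section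

section TaylorBounds

variable {E F : Type*} [NormedAddCommGroup E] [NormedAddCommGroup F] [NormedSpace ℝ F]

theorem norm_sub_le_of_norm_deriv_le_pow {φ φ' : ℝ → F} {C : ℝ} {n : ℕ}
    (hφ : ∀ t ∈ Set.Icc (0 : ℝ) 1, HasDerivAt φ (φ' t) t)
    (hbound : ∀ t ∈ Set.Icc (0 : ℝ) 1, ‖φ' t‖ ≤ C * t ^ n) :
    ‖φ 1 - φ 0‖ ≤ C / (n + 1) := by
  have hB : ∀ t : ℝ, HasDerivAt (fun t : ℝ => C / (n + 1) * t ^ (n + 1)) (C * t ^ n) t := by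
    intro t
    refine ((hasDerivAt_pow (n + 1) t).const_mul (C / (n + 1))).congr_deriv ?_
    have : (n : ℝ) + 1 ≠ 0 := by positivity
    rw [Nat.add_sub_cancel]
    push_cast
    field_simp
  have h := image_norm_le_of_norm_deriv_right_le_deriv_boundary
    (f := fun t => φ t - φ 0) (f' := φ') (a := 0) (b := 1)
    (fun t ht => ((hφ t ht).sub_const _).continuousAt.continuousWithinAt)
    (fun t ht => ((hφ t ⟨ht.1, ht.2.le⟩).sub_const _).hasDerivWithinAt)
    (by simp) hB (fun t ht => hbound t ⟨ht.1, ht.2.le⟩) (x := 1) (by simp)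
  simpa using h

theorem hasDerivAt_add_smul_const [NormedSpace ℝ E] (x v : E) (t : ℝ) :
    HasDerivAt (fun t : ℝ => x + t • v) v t := by
  simpa using ((hasDerivAt_id t).smul_const v).const_add x

/-- First-order Taylor remainder for a map whose derivative is Lipschitz on a convex set. -/
theorem norm_taylor_one_le [NormedSpace ℝ E] {Ω : Set E} (hΩ : Convex ℝ Ω) {h : E → F}
    {h' : E → E →L[ℝ] F} {L : ℝ≥0} (hh : ∀ y ∈ Ω, HasFDerivAt h (h' y) y)
    (hL : LipschitzOnWith L h' Ω) {x v : E} (hx : x ∈ Ω) (hxv : x + v ∈ Ω) :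
    ‖h (x + v) - h x - h' x v‖ ≤ L / 2 * ‖v‖ ^ 2 := by
  have key := norm_sub_le_of_norm_deriv_le_pow (n := 1) (C := L * ‖v‖ ^ 2)
    (φ := fun t : ℝ => h (x + t • v) - t • h' x v) (φ' := fun t => h' (x + t • v) v - h' x v)
    (fun t ht => by
      have h1 := (hh _ (hΩ.add_smul_mem hx hxv ht)).comp_hasDerivAt t
        (hasDerivAt_add_smul_const x v t)
      exact (h1.sub ((hasDerivAt_id t).smul_const (h' x v))).congr_deriv (by simp))
    (fun t ht => by
      have h1 := hL.norm_sub_le (hΩ.add_smul_mem hx hxv ht) hx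
      rw [add_sub_cancel_left, norm_smul, Real.norm_of_nonneg ht.1] at h1
      calc ‖h' (x + t • v) v - h' x v‖ = ‖(h' (x + t • v) - h' x) v‖ := by simp
        _ ≤ ‖h' (x + t • v) - h' x‖ * ‖v‖ := ContinuousLinearMap.le_opNorm _ _
        _ ≤ L * (t * ‖v‖) * ‖v‖ := by gcongr
        _ = L * ‖v‖ ^ 2 * t ^ 1 := by ring)
  calc _ = _ := by
        congr 1
        simp only [one_smul, zero_smul, add_zero, sub_zero]
        abel
    _ ≤ _ := key
    _ = _ := by push_cast; ring

/-- Second-order Taylor remainder for a function whose Hessian is Lipschitz on a convex set. -/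
theorem abs_taylor_two_le {E : Type*} [NormedAddCommGroup E] [InnerProductSpace ℝ E]
    [CompleteSpace E] {Ω : Set E}
    (hΩ : Convex ℝ Ω) {h : E → ℝ} {g : E → E} {H : E → E →L[ℝ] E} {L : ℝ≥0}
    (hg : ∀ y ∈ Ω, HasGradientAt h (g y) y) (hH : ∀ y ∈ Ω, HasFDerivAt g (H y) y)
    (hL : LipschitzOnWith L H Ω) {x v : E} (hx : x ∈ Ω) (hxv : x + v ∈ Ω) :
    |h (x + v) - h x - ⟪g x, v⟫ - 1 / 2 * ⟪v, H x v⟫| ≤ L / 6 * ‖v‖ ^ 3 := by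
  have key := norm_sub_le_of_norm_deriv_le_pow (n := 2) (C := L / 2 * ‖v‖ ^ 3)
    (φ := fun t : ℝ => h (x + t • v) - t * ⟪g x, v⟫ - t ^ 2 * (1 / 2 * ⟪v, H x v⟫))
    (φ' := fun t => ⟪g (x + t • v) - g x - H x (t • v), v⟫)
    (fun t ht => by
      have h1 := (hg _ (hΩ.add_smul_mem hx hxv ht)).hasFDerivAt.comp_hasDerivAt t
        (hasDerivAt_add_smul_const x v t)
      refine ((h1.sub ((hasDerivAt_id t).mul_const ⟪g x, v⟫)).sub
        ((hasDerivAt_pow 2 t).mul_const (1 / 2 * ⟪v, H x v⟫))).congr_deriv ?_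
      simp only [inner_sub_left, map_smul, inner_smul_left, InnerProductSpace.toDual_apply_apply,
        real_inner_comm v (H x v)]
      simp
      ring)
    (fun t ht => by
      have hmem := hΩ.add_smul_mem hx hxv ht
      have h1 := norm_taylor_one_le hΩ hH hL hx hmem
      rw [norm_smul, Real.norm_of_nonneg ht.1] at h1
      calc _ ≤ ‖g (x + t • v) - g x - H x (t • v)‖ * ‖v‖ := norm_inner_le_norm _ _
        _ ≤ L / 2 * (t * ‖v‖) ^ 2 * ‖v‖ := by gcongr
        _ = L / 2 * ‖v‖ ^ 3 * t ^ 2 := by ring)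
  rw [← Real.norm_eq_abs]
  calc _ = _ := by
        congr 1
        simp only [one_smul, zero_smul, add_zero]
        ring
    _ ≤ _ := key
    _ = _ := by push_cast; ring

end TaylorBounds

section RightInverse

variable {E F : Type*} [NormedAddCommGroup E] [InnerProductSpace ℝ E] [CompleteSpace E]
  [NormedAddCommGroup F] [InnerProductSpace ℝ F] [CompleteSpace F]
  {A : E →L[ℝ] F} {W : F →L[ℝ] F} {κ : ℝ}

theorem sqrt_mul_norm_le_norm_adjoint
    (hpos : ∀ v, κ * ‖v‖ ^ 2 ≤ ⟪A (adjoint A v), v⟫) (v : F) :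
    Real.sqrt κ * ‖v‖ ≤ ‖adjoint A v‖ := by
  have h := hpos v
  rw [← adjoint_inner_right, real_inner_self_eq_norm_sq] at h
  rw [← Real.sqrt_sq (norm_nonneg v), ← Real.sqrt_mul' _ (sq_nonneg _)]
  exact Real.sqrt_le_iff.2 ⟨norm_nonneg _, h⟩

theorem sqrt_mul_norm_adjoint_inv_le
    (hpos : ∀ v, κ * ‖v‖ ^ 2 ≤ ⟪A (adjoint A v), v⟫)
    (hW : ∀ v, A (adjoint A (W v)) = v) (r : F) :
    Real.sqrt κ * ‖adjoint A (W r)‖ ≤ ‖r‖ := by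
  have h1 := sqrt_mul_norm_le_norm_adjoint hpos (W r)
  have h2 : ‖adjoint A (W r)‖ ^ 2 ≤ ‖r‖ * ‖W r‖ := by
    rw [← real_inner_self_eq_norm_sq, adjoint_inner_right, hW]
    exact real_inner_le_norm _ _
  rcases (norm_nonneg (adjoint A (W r))).eq_or_lt with h0 | h0
  · rw [← h0]; simp
  · refine le_of_mul_le_mul_right ?_ h0
    nlinarith [Real.sqrt_nonneg κ, norm_nonneg r, mul_le_mul_of_nonneg_left h1 (norm_nonneg r),
      mul_le_mul_of_nonneg_left h2 (Real.sqrt_nonneg κ)]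

theorem sqrt_mul_norm_inv_apply_le
    (hpos : ∀ v, κ * ‖v‖ ^ 2 ≤ ⟪A (adjoint A v), v⟫)
    (hW : ∀ v, A (adjoint A (W v)) = v) (u : E) :
    Real.sqrt κ * ‖W (A u)‖ ≤ ‖u‖ := by
  refine (sqrt_mul_norm_le_norm_adjoint hpos _).trans ?_
  have h2 : ‖adjoint A (W (A u))‖ ^ 2 ≤ ‖u‖ * ‖adjoint A (W (A u))‖ := by
    rw [← real_inner_self_eq_norm_sq, adjoint_inner_right, hW, ← adjoint_inner_right]
    exact real_inner_le_norm _ _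
  nlinarith [norm_nonneg u, norm_nonneg (adjoint A (W (A u)))]

theorem inner_adjoint_inv_eq (hW : ∀ v, A (adjoint A (W v)) = v) (u : E) (r : F) :
    ⟪u, adjoint A (W r)⟫ = ⟪W (A u), r⟫ :=
  calc ⟪u, adjoint A (W r)⟫ = ⟪A (adjoint A (W (A u))), W r⟫ := by rw [adjoint_inner_right, hW]
    _ = ⟪adjoint A (W (A u)), adjoint A (W r)⟫ := (adjoint_inner_right A _ _).symm
    _ = ⟪W (A u), r⟫ := by rw [adjoint_inner_left, hW]

end RightInverse

theorem EuclideanSpace.norm_le_sqrt_mul {m : ℕ} {v : EuclideanSpace ℝ (Fin m)} {b : ℝ}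
    (hb : 0 ≤ b) (h : ∀ i, |v i| ≤ b) : ‖v‖ ≤ Real.sqrt m * b := by
  rw [EuclideanSpace.norm_eq]
  refine Real.sqrt_le_iff.2 ⟨by positivity, ?_⟩
  rw [mul_pow, Real.sq_sqrt (Nat.cast_nonneg m)]
  calc ∑ i, ‖v i‖ ^ 2 ≤ ∑ _i : Fin m, b ^ 2 := by
        gcongr with i
        exact h i
    _ = m * b ^ 2 := by simp

/-- Linearization error of a constraint map at a corrected point `x + s + e`, where `e` cancels
the first-order Taylor remainder of `c` along `s`. -/
theorem norm_corrected_constraint_sub_le {E F : Type*} [NormedAddCommGroup E] [NormedSpace ℝ E]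
    [NormedAddCommGroup F] [NormedSpace ℝ F] {Ω : Set E} (hΩ : Convex ℝ Ω) {c : E → F}
    {G : E → E →L[ℝ] F} {L : ℝ≥0} (hc : ∀ y ∈ Ω, HasFDerivAt c (G y) y)
    (hG : LipschitzOnWith L G Ω) {x s e : E} (hx : x ∈ Ω) (hxs : x + s ∈ Ω)
    (hxse : x + s + e ∈ Ω) (he : G x e = -(c (x + s) - c x - G x s)) :
    ‖c (x + s + e) - (c x + G x s)‖ ≤ L * ‖s‖ * ‖e‖ + L / 2 * ‖e‖ ^ 2 := by
  have h1 := norm_taylor_one_le hΩ hc hG hxs hxse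
  have h2 := hG.norm_sub_le hxs hx
  rw [add_sub_cancel_left] at h2
  have h3 : ‖(G (x + s) - G x) e‖ ≤ L * ‖s‖ * ‖e‖ :=
    (ContinuousLinearMap.le_opNorm _ _).trans (by gcongr)
  calc ‖c (x + s + e) - (c x + G x s)‖
      = ‖(G (x + s) - G x) e + (c (x + s + e) - c (x + s) - G (x + s) e)‖ := by
        rw [sub_apply, he]
        congr 1
        abel
    _ ≤ _ := (norm_add_le _ _).trans (add_le_add h3 h1)

theorem abs_corrected_objective_sub_le {E : Type*} [NormedAddCommGroup E] [InnerProductSpace ℝ E]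
    [CompleteSpace E] {Ω : Set E} (hΩ : Convex ℝ Ω) {f : E → ℝ} {g : E → E} {H : E → E →L[ℝ] E}
    {L₁ L₂ : ℝ≥0} (hf : ∀ y ∈ Ω, HasGradientAt f (g y) y) (hg : ∀ y ∈ Ω, HasFDerivAt g (H y) y)
    (hL₁ : LipschitzOnWith L₁ g Ω) (hL₂ : LipschitzOnWith L₂ H Ω)
    {x s e : E} (hx : x ∈ Ω) (hxs : x + s ∈ Ω) (hxse : x + s + e ∈ Ω) :
    |f (x + s + e) - f x - ⟪g x, s⟫ - 1 / 2 * ⟪s, H x s⟫ - ⟪g x, e⟫| ≤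
      L₂ / 6 * ‖s‖ ^ 3 + L₁ * ‖s‖ * ‖e‖ + L₁ / 2 * ‖e‖ ^ 2 := by
  have h1 := abs_taylor_two_le hΩ hf hg hL₂ hx hxs
  have hdual : LipschitzOnWith L₁ (fun y => InnerProductSpace.toDual ℝ E (g y)) Ω :=
    LipschitzOnWith.of_dist_le_mul fun y hy z hz => by
      rw [LinearIsometryEquiv.dist_map]
      exact hL₁.dist_le_mul y hy z hz
  have h2 := norm_taylor_one_le hΩ (fun y hy => (hf y hy).hasFDerivAt) hdual hxs hxse
  rw [InnerProductSpace.toDual_apply_apply, Real.norm_eq_abs] at h2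
  have h3 := hL₁.norm_sub_le hxs hx
  rw [add_sub_cancel_left] at h3
  have h4 : |⟪g (x + s) - g x, e⟫| ≤ L₁ * ‖s‖ * ‖e‖ :=
    (abs_real_inner_le_norm _ _).trans (by gcongr)
  rw [inner_sub_left] at h4
  rw [abs_le] at *
  constructor <;> linarith [h1.1, h1.2, h2.1, h2.2, h4.1, h4.2]

theorem norm_constraint_taylor_two_le {d m : ℕ} {Ω : Set (EuclideanSpace ℝ (Fin d))}
    (hΩ : Convex ℝ Ω) {c : EuclideanSpace ℝ (Fin d) → EuclideanSpace ℝ (Fin m)}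
    {G : EuclideanSpace ℝ (Fin d) → EuclideanSpace ℝ (Fin d) →L[ℝ] EuclideanSpace ℝ (Fin m)}
    {H : Fin m → EuclideanSpace ℝ (Fin d) →
      EuclideanSpace ℝ (Fin d) →L[ℝ] EuclideanSpace ℝ (Fin d)}
    {L : ℝ≥0} (hc : ∀ y ∈ Ω, HasFDerivAt c (G y) y)
    (hG : ∀ i, ∀ y ∈ Ω,
      HasFDerivAt (fun z => adjoint (G z) (EuclideanSpace.single i 1)) (H i y) y)
    (hH : ∀ i, LipschitzOnWith L (H i) Ω)
    {x s : EuclideanSpace ℝ (Fin d)} (hx : x ∈ Ω) (hxs : x + s ∈ Ω) :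
    ‖c (x + s) - c x - G x s - (1 / 2 : ℝ) • WithLp.toLp 2 (fun i => ⟪s, H i x s⟫)‖ ≤
      Real.sqrt m * (L / 6 * ‖s‖ ^ 3) := by
  refine EuclideanSpace.norm_le_sqrt_mul (by positivity) fun i => ?_
  have hgrad : ∀ y ∈ Ω, HasGradientAt (fun z => c z i)
      (adjoint (G y) (EuclideanSpace.single i 1)) y := by
    intro y hy
    rw [hasGradientAt_iff_hasFDerivAt]
    refine ((EuclideanSpace.proj (𝕜 := ℝ) i).hasFDerivAt.comp y (hc y hy)).congr_fderiv ?_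
    ext v
    simp [adjoint_inner_left, EuclideanSpace.inner_single_left]
  have h := abs_taylor_two_le hΩ hgrad (hG i) (hH i) hx hxs
  rw [adjoint_inner_left, EuclideanSpace.inner_single_left] at h
  simpa using h

theorem norm_constraint_curvature_le {d m : ℕ} {s : EuclideanSpace ℝ (Fin d)}
    {H : Fin m → EuclideanSpace ℝ (Fin d) →L[ℝ] EuclideanSpace ℝ (Fin d)} {L : ℝ}
    (hL : 0 ≤ L) (hH : ∀ i, ‖H i‖ ≤ L) :
    ‖(WithLp.toLp 2 (fun i => ⟪s, H i s⟫) : EuclideanSpace ℝ (Fin m))‖ ≤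
      Real.sqrt m * (L * ‖s‖ ^ 2) := by
  refine EuclideanSpace.norm_le_sqrt_mul (by positivity) fun i => ?_
  calc |⟪s, H i s⟫| ≤ ‖s‖ * ‖H i s‖ := abs_real_inner_le_norm _ _
    _ ≤ ‖s‖ * (L * ‖s‖) := by gcongr; exact (H i).le_of_opNorm_le (hH i) s
    _ = L * ‖s‖ ^ 2 := by ring

/-- The combined error of the corrected step, with `S`, `N` bounding the lengths of the step and
of the correction, `M` standing for `√m` and `a` for `1 / √κ₁`. -/
theorem correction_error_le {Lf Lh L Lc κ κ_g M a Δ Δmax μ μhat S N : ℝ}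
    (hLf : 0 ≤ Lf) (hLh : 0 ≤ Lh) (hL : 0 ≤ L) (hLc : 0 ≤ Lc) (hκ : 0 ≤ κ) (hκg : 0 ≤ κ_g)
    (hM0 : 0 ≤ M) (ha0 : 0 ≤ a) (hΔ0 : 0 ≤ Δ) (hΔ : Δ ≤ Δmax) (hμ0 : 0 ≤ μ) (hμ : μ ≤ μhat)
    (hS0 : 0 ≤ S) (hS : S ≤ Δ) (hN0 : 0 ≤ N) (hN : N ≤ M * (L / 2 * Δ ^ 2) * a)
    (hNsq : N ^ 2 ≤ (L / 2 * Δ ^ 2 * a) * (L / 2 * Δ ^ 2 * a))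
    (hNsqM : N ^ 2 ≤ (M * (L / 2 * Δ ^ 2) * a) * (L / 2 * Δ ^ 2 * a)) :
    Lh / 6 * S ^ 3 + Lf * S * N + Lf / 2 * N ^ 2 + μ * (L * S * N + L / 2 * N ^ 2) +
        κ * a * (M * (Lc / 6 * Δ ^ 3)) + 1 / 2 * (κ_g * Δ ^ 2 * a * (M * (L * Δ ^ 2))) ≤
      (Lh / 2 + L ^ 2 * Δmax * (0.5 * Lf + M * μhat * L) * a ^ 2 +
        (0.5 * M * Lc * (Lf * Δmax + κ) +
          0.5 * M * L * (κ_g * Δmax + Lf + 2 * μhat * L)) * a) * Δ ^ 3 := by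
  have hμhat : 0 ≤ μhat := hμ0.trans hμ
  have hΔmax : 0 ≤ Δmax := hΔ0.trans hΔ
  have h_step_cubic : Lh / 6 * S ^ 3 ≤ Lh / 2 * Δ ^ 3 := by gcongr; norm_num
  have h_grad_change : Lf * S * N ≤ 0.5 * M * L * Lf * a * Δ ^ 3 :=
    calc _ ≤ Lf * Δ * (M * (L / 2 * Δ ^ 2) * a) := by gcongr
      _ = _ := by ring
  have h_grad_taylor : Lf / 2 * N ^ 2 ≤ L ^ 2 * Δmax * (0.5 * Lf) * a ^ 2 * Δ ^ 3 :=
    calc _ ≤ Lf / 2 * ((L / 2 * Δ ^ 2 * a) * (L / 2 * Δ ^ 2 * a)) := by gcongr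
      _ = 1 / 4 * (L ^ 2 * Δ * (0.5 * Lf) * a ^ 2 * Δ ^ 3) := by ring
      _ ≤ 1 * (L ^ 2 * Δmax * (0.5 * Lf) * a ^ 2 * Δ ^ 3) := by gcongr; norm_num
      _ = _ := one_mul _
  have h_jac_change : μ * (L * S * N) ≤ 0.5 * M * L * (2 * μhat * L) * a * Δ ^ 3 :=
    calc _ ≤ μhat * (L * Δ * (M * (L / 2 * Δ ^ 2) * a)) := by gcongr
      _ = 1 / 2 * (0.5 * M * L * (2 * μhat * L) * a * Δ ^ 3) := by ring
      _ ≤ 1 * (0.5 * M * L * (2 * μhat * L) * a * Δ ^ 3) := by gcongr; norm_num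
      _ = _ := one_mul _
  have h_jac_taylor : μ * (L / 2 * N ^ 2) ≤ L ^ 2 * Δmax * (M * μhat * L) * a ^ 2 * Δ ^ 3 :=
    calc _ ≤ μhat * (L / 2 * ((M * (L / 2 * Δ ^ 2) * a) * (L / 2 * Δ ^ 2 * a))) := by gcongr
      _ = 1 / 8 * (L ^ 2 * Δ * (M * μhat * L) * a ^ 2 * Δ ^ 3) := by ring
      _ ≤ 1 * (L ^ 2 * Δmax * (M * μhat * L) * a ^ 2 * Δ ^ 3) := by gcongr; norm_num
      _ = _ := one_mul _
  have h_constraint_taylor : κ * a * (M * (Lc / 6 * Δ ^ 3)) ≤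
      0.5 * M * Lc * (Lf * Δmax + κ) * a * Δ ^ 3 :=
    calc _ = 1 / 3 * (0.5 * M * Lc * (0 + κ) * a * Δ ^ 3) := by ring
      _ ≤ 1 * (0.5 * M * Lc * (Lf * Δmax + κ) * a * Δ ^ 3) := by
        gcongr
        · norm_num
        · positivity
      _ = _ := one_mul _
  have h_multiplier : 1 / 2 * (κ_g * Δ ^ 2 * a * (M * (L * Δ ^ 2))) ≤
      0.5 * M * L * (κ_g * Δmax) * a * Δ ^ 3 :=
    calc _ = 0.5 * M * L * (κ_g * Δ) * a * Δ ^ 3 := by ring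
      _ ≤ _ := by gcongr
  linarith

/-- a sufficiently negative predicted reduction driven by the estimated negative
curvature `τ̄⁺` forces a successful iteration (`Ared/Pred ≥ η`) when the actual reduction is
computed at the second-order-corrected trial point `x+s+d` (part of Lemma 7 of the paper).
Setup as in Statement 7: `Gᵀ` is the adjoint, `W` plays the role of `(G(x)G(x)ᵀ)⁻¹`,
`d = −G(x)ᵀ(G(x)G(x)ᵀ)⁻¹(c(x+s) − c(x) − G(x)s)`, `λ̄ = −(G(x)G(x)ᵀ)⁻¹G(x)ḡ`,
`H̄ = ∇̄²f + Σᵢ λ̄ⁱ ∇²cⁱ(x)`, and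
`Pred = ḡᵀs + (1/2)sᵀH̄s + μ(‖c(x) + G(x)s‖ − ‖c(x)‖)`. -/
theorem stmt_10 {d m : ℕ}
    (Ω : Set (EuclideanSpace ℝ (Fin d))) (hΩopen : IsOpen Ω) (hΩconv : Convex ℝ Ω)
    (f : EuclideanSpace ℝ (Fin d) → ℝ)
    (g : EuclideanSpace ℝ (Fin d) → EuclideanSpace ℝ (Fin d))
    (Hf : EuclideanSpace ℝ (Fin d) → (EuclideanSpace ℝ (Fin d) →L[ℝ] EuclideanSpace ℝ (Fin d)))
    (c : EuclideanSpace ℝ (Fin d) → EuclideanSpace ℝ (Fin m))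
    (G : EuclideanSpace ℝ (Fin d) → (EuclideanSpace ℝ (Fin d) →L[ℝ] EuclideanSpace ℝ (Fin m)))
    (Hc : Fin m → EuclideanSpace ℝ (Fin d) →
      (EuclideanSpace ℝ (Fin d) →L[ℝ] EuclideanSpace ℝ (Fin d)))
    (L_gradf L_hessf L_G L_hessc : ℝ≥0)
    (κ_gradf κ_g κ_h κ_f κ_fcd η κ₁ μ μhat Δ Δmax τbarplus : ℝ)
    (x s gbar : EuclideanSpace ℝ (Fin d))
    (Hfbar : EuclideanSpace ℝ (Fin d) →L[ℝ] EuclideanSpace ℝ (Fin d))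
    (W : EuclideanSpace ℝ (Fin m) →L[ℝ] EuclideanSpace ℝ (Fin m))
    -- smoothness of the objective
    (hgrad : ∀ y ∈ Ω, HasGradientAt f (g y) y)
    (hhess : ∀ y ∈ Ω, HasFDerivAt g (Hf y) y)
    (hglip : LipschitzOnWith L_gradf g Ω)
    (hHfbound : ∀ y ∈ Ω, ‖Hf y‖ ≤ (L_gradf : ℝ))
    (hHflip : LipschitzOnWith L_hessf Hf Ω)
    (hgx : ‖g x‖ ≤ κ_gradf)
    -- smoothness of the constraints
    (hjac : ∀ y ∈ Ω, HasFDerivAt c (G y) y)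
    (hGlip : LipschitzOnWith L_G G Ω)
    (hhessc : ∀ i, ∀ y ∈ Ω,
      HasFDerivAt (fun z => adjoint (G z) (EuclideanSpace.single i 1)) (Hc i y) y)
    (hHclip : ∀ i, LipschitzOnWith L_hessc (Hc i) Ω)
    (hHcx : ∀ i, ‖Hc i x‖ ≤ (L_G : ℝ))
    -- constraint qualification at x
    (hκ₁ : 0 < κ₁)
    (hGpos : ∀ v : EuclideanSpace ℝ (Fin m), κ₁ * ‖v‖ ^ 2 ≤ ⟪G x (adjoint (G x) v), v⟫)
    (hW₁ : ∀ v, W (G x (adjoint (G x) v)) = v)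
    (hW₂ : ∀ v, G x (adjoint (G x) (W v)) = v)
    -- constants
    (hη0 : 0 < η) (hη1 : η < 1) (hκfcd0 : 0 < κ_fcd) (hκfcd1 : κ_fcd ≤ 1)
    (hκg : 0 < κ_g) (hκh : 0 < κ_h) (hκf : 0 < κ_f)
    (hΔmax : 0 < Δmax) (hμhat : 0 < μhat)
    -- the step, the SOC step, and the radius
    (hx : x ∈ Ω) (hs : ‖s‖ ≤ Δ) (hΔ0 : 0 < Δ) (hΔ : Δ ≤ Δmax)
    (hxs : x + s ∈ Ω)
    (hxsd : x + s + (-(adjoint (G x)) (W (c (x + s) - c x - G x s))) ∈ Ω)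
    -- accuracy of the random estimates
    (hgacc : ‖gbar - g x‖ ≤ κ_g * Δ ^ 2)
    (hHfbarsym : IsSelfAdjoint Hfbar)
    (hHfacc : ‖Hfbar - Hf x‖ ≤ κ_h * Δ)
    -- merit parameter and negative-curvature estimate
    (hμ0 : 0 < μ) (hμ : μ ≤ μhat) (hτbar0 : 0 ≤ τbarplus)
    -- objective-value estimates
    (fbar_k fbar_s : ℝ)
    (hfk : |fbar_k - f x| ≤ κ_f * Δ ^ 3)
    (hfs : |fbar_s - f (x + s + (-(adjoint (G x)) (W (c (x + s) - c x - G x s))))| ≤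
      κ_f * Δ ^ 3)
    -- the main hypotheses
    (hPred : ⟪gbar, s⟫ +
        1 / 2 * ⟪s, (Hfbar + ∑ i, (-(W (G x gbar))) i • Hc i x) s⟫ +
        μ * (‖c x + G x s‖ - ‖c x‖) ≤ -(κ_fcd / 2) * τbarplus * Δ ^ 2)
    (hτbarpos : 0 < τbarplus)
    (hgap : (4 * κ_f +
        2 * (κ_g + ((L_hessf : ℝ) + κ_h) / 2 +
          (L_G : ℝ) ^ 2 * Δmax * (0.5 * (L_gradf : ℝ) + Real.sqrt m * μhat * (L_G : ℝ)) / κ₁ +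
          (0.5 * Real.sqrt m * (L_hessc : ℝ) * ((L_gradf : ℝ) * Δmax + κ_gradf) +
            0.5 * Real.sqrt m * (L_G : ℝ) *
              (κ_g * Δmax + (L_gradf : ℝ) + 2 * μhat * (L_G : ℝ))) / Real.sqrt κ₁)) * Δ ≤
      (1 - η) * κ_fcd * τbarplus) :
    (⟪gbar, s⟫ +
        1 / 2 * ⟪s, (Hfbar + ∑ i, (-(W (G x gbar))) i • Hc i x) s⟫ +
        μ * (‖c x + G x s‖ - ‖c x‖) < 0) ∧
    (fbar_s - fbar_k +
        μ * (‖c (x + s + (-(adjoint (G x)) (W (c (x + s) - c x - G x s))))‖ - ‖c x‖) ≤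
      η * (⟪gbar, s⟫ +
        1 / 2 * ⟪s, (Hfbar + ∑ i, (-(W (G x gbar))) i • Hc i x) s⟫ +
        μ * (‖c x + G x s‖ - ‖c x‖))) := by
  have hL := L_G.coe_nonneg
  have hLf := L_gradf.coe_nonneg
  have hLh := L_hessf.coe_nonneg
  have hLc := L_hessc.coe_nonneg
  have hκgrad : 0 ≤ κ_gradf := (norm_nonneg _).trans hgx
  have hk : 0 < Real.sqrt κ₁ := Real.sqrt_pos.2 hκ₁
  set r := c (x + s) - c x - G x s with hr_def
  set e := -(adjoint (G x)) (W r) with he_def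
  set q : EuclideanSpace ℝ (Fin m) := WithLp.toLp 2 (fun i => ⟪s, Hc i x s⟫) with hq_def
  obtain ⟨M, hM⟩ : ∃ M, M = Real.sqrt m := ⟨_, rfl⟩
  have hM0 : 0 ≤ M := hM ▸ Real.sqrt_nonneg _
  obtain ⟨a, ha⟩ : ∃ a, a = (Real.sqrt κ₁)⁻¹ := ⟨_, rfl⟩
  have ha0 : 0 ≤ a := ha ▸ (inv_pos.2 hk).le
  have ha2 : κ₁⁻¹ = a ^ 2 := by rw [ha, inv_pow, Real.sq_sqrt hκ₁.le]
  have hGe : G x e = -r := by rw [he_def, map_neg, hW₂]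
  have hr : ‖r‖ ≤ L_G / 2 * Δ ^ 2 :=
    (norm_taylor_one_le hΩconv hjac hGlip hx hxs).trans (by gcongr)
  have hrm : ‖r‖ ≤ M * (L_G / 2 * Δ ^ 2) := by
    rcases Nat.eq_zero_or_pos m with rfl | hmpos
    · have : r = 0 := Subsingleton.elim _ _
      rw [this, norm_zero]
      positivity
    · have : 1 ≤ M := hM ▸ Real.one_le_sqrt.2 (by exact_mod_cast hmpos)
      exact hr.trans (le_mul_of_one_le_left (by positivity) this)
  have he : ‖e‖ ≤ ‖r‖ * a := by
    rw [he_def, norm_neg, ha, ← div_eq_mul_inv, le_div_iff₀ hk, mul_comm]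
    exact sqrt_mul_norm_adjoint_inv_le hGpos hW₂ r
  have hmult : ∀ u, ‖W (G x u)‖ ≤ ‖u‖ * a := fun u => by
    rw [ha, ← div_eq_mul_inv, le_div_iff₀ hk, mul_comm]
    exact sqrt_mul_norm_inv_apply_le hGpos hW₂ u
  have heM : ‖e‖ ≤ M * (L_G / 2 * Δ ^ 2) * a := he.trans (by gcongr)
  have hesq : ‖e‖ ^ 2 ≤ (L_G / 2 * Δ ^ 2 * a) * (L_G / 2 * Δ ^ 2 * a) := by
    rw [sq]
    have := he.trans (mul_le_mul_of_nonneg_right hr ha0)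
    gcongr
  have hesqM : ‖e‖ ^ 2 ≤ (M * (L_G / 2 * Δ ^ 2) * a) * (L_G / 2 * Δ ^ 2 * a) := by
    rw [sq]
    have := he.trans (mul_le_mul_of_nonneg_right hr ha0)
    gcongr
  have hobj := abs_corrected_objective_sub_le hΩconv hgrad hhess hglip hHflip hx hxs hxsd
  have hcon : ‖c (x + s + e)‖ - ‖c x + G x s‖ ≤ L_G * ‖s‖ * ‖e‖ + L_G / 2 * ‖e‖ ^ 2 :=
    (norm_sub_norm_le _ _).trans
      (norm_corrected_constraint_sub_le hΩconv hjac hGlip hx hxs hxsd hGe)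
  have hq : ‖q‖ ≤ M * (L_G * Δ ^ 2) :=
    hM ▸ (norm_constraint_curvature_le hL hHcx).trans (by gcongr)
  have hrq : ‖r - (1 / 2 : ℝ) • q‖ ≤ M * (L_hessc / 6 * Δ ^ 3) :=
    hM ▸ (norm_constraint_taylor_two_le hΩconv hjac hhessc hHclip hx hxs).trans (by gcongr)
  have hinner_e : ⟪g x, e⟫ = -⟪W (G x (g x)), r⟫ := by
    rw [he_def, inner_neg_right, inner_adjoint_inv_eq hW₂]
  have hquad : ⟪s, (Hfbar + ∑ i, (-(W (G x gbar))) i • Hc i x) s⟫ =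
      ⟪s, Hfbar s⟫ - ⟪W (G x gbar), q⟫ := by
    simp [inner_add_right, inner_sum, inner_smul_right, hq_def, PiLp.inner_apply, mul_comm,
      sub_eq_add_neg]
  have hdiff : ⟪W (G x (g x)), r⟫ - 1 / 2 * ⟪W (G x gbar), q⟫ =
      ⟪W (G x (g x)), r - (1 / 2 : ℝ) • q⟫ - 1 / 2 * ⟪W (G x (gbar - g x)), q⟫ := by
    simp only [map_sub, inner_sub_left, inner_sub_right, inner_smul_right]
    ring
  have hmultr : |⟪W (G x (g x)), r - (1 / 2 : ℝ) • q⟫| ≤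
      κ_gradf * a * (M * (L_hessc / 6 * Δ ^ 3)) := by
    have := hmult (g x)
    exact (abs_real_inner_le_norm _ _).trans (by gcongr; exact this.trans (by gcongr))
  have hmultq : |⟪W (G x (gbar - g x)), q⟫| ≤ κ_g * Δ ^ 2 * a * (M * (L_G * Δ ^ 2)) := by
    have := hmult (gbar - g x)
    exact (abs_real_inner_le_norm _ _).trans (by gcongr; exact this.trans (by gcongr))
  have hgs : |⟪gbar - g x, s⟫| ≤ κ_g * Δ ^ 2 * Δ :=
    (abs_real_inner_le_norm _ _).trans (by gcongr)
  have hHs : |⟪s, (Hfbar - Hf x) s⟫| ≤ Δ * (κ_h * Δ * Δ) :=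
    (abs_real_inner_le_norm _ _).trans (by
      gcongr
      exact (ContinuousLinearMap.le_opNorm _ _).trans (by gcongr))
  rw [inner_sub_left] at hgs
  rw [sub_apply, inner_sub_right] at hHs
  rw [div_eq_mul_inv _ κ₁, div_eq_mul_inv _ (Real.sqrt κ₁), ha2, ← ha, ← hM] at hgap
  rw [hquad] at hPred ⊢
  have herr := correction_error_le hLf hLh hL hLc hκgrad hκg.le hM0 ha0 hΔ0.le hΔ hμ0.le hμ
    (norm_nonneg s) hs (norm_nonneg e) heM hesq hesqM
  have hgapΔ := mul_le_mul_of_nonneg_right hgap (sq_nonneg Δ)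
  have hμcon := mul_le_mul_of_nonneg_left hcon hμ0.le
  have hPredη := mul_le_mul_of_nonneg_left hPred (sub_pos.2 hη1).le
  have hpos : 0 < κ_fcd / 2 * τbarplus * Δ ^ 2 := by positivity
  refine ⟨by linarith, ?_⟩
  rw [abs_le] at hobj hmultr hmultq hgs hHs hfk hfs
  linarith [hobj.2, hmultr.1, hmultq.2, hmultq.1, hmultr.2, hgs.1, hHs.1, hfk.1, hfs.2]
end
end

section
/- There is a constant μ̃ > 0, determined only by κ_B, κ_c, κ_{∇f}, M, κ₁, κ₂, and Δ_max, such that for every configuration satisfying the stated hypotheses and every μ ≥ μ̃, the eigen step satisfies the sufficient-reduction condition Pred ≤ −(κ_fcd/2)·τ̄⁺·Δ·(Δ + ‖c‖). -/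
open scoped RealInnerProductSpace NNReal Classical
open ContinuousLinearMap

noncomputable section

/-- Elementary estimate: the curvature reduction lost by shortening the radius to `T / N * Δ`
is controlled by the linearized feasibility reduction `γ * a`. -/
lemma curvature_loss_le {a L n t Δ y γ s S κc κB D : ℝ}
    (ha : 0 < a) (hac : a ≤ κc) (hs : 0 < s) (hsL : s ≤ L) (hLS : L ≤ S)
    (hn : 0 < n) (hnB : n ≤ κB) (ht : 0 < t) (htn : t ≤ n) (hΔ : 0 < Δ) (hΔD : Δ ≤ D)
    (hy : 0 < y) (hya : s * y ≤ a)
    (hγ : γ = min (a / L / √(a ^ 2 / L ^ 2 + (t / n) ^ 2) * Δ / y) 1) :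
    t * (Δ * (Δ + a) - (t / n / √(a ^ 2 / L ^ 2 + (t / n) ^ 2) * Δ) ^ 2) ≤
      (κB * D ^ 2 / s + κB * D + κB * D / s + κB * (κc + S) / s) * (γ * a) := by
  have hL : 0 < L := hs.trans_le hsL
  have hS : 0 < S := hL.trans_le hLS
  have hκB : 0 < κB := hn.trans_le hnB
  have hκc : 0 < κc := ha.trans_le hac
  have hD : 0 < D := hΔ.trans_le hΔD
  obtain ⟨C, hC⟩ : ∃ C, C = a / L := ⟨_, rfl⟩
  obtain ⟨T, hT⟩ : ∃ T, T = t / n := ⟨_, rfl⟩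
  rw [← div_pow, ← hC, ← hT] at hγ
  rw [← div_pow, ← hC, ← hT]
  have hC0 : 0 < C := hC ▸ by positivity
  have hT0 : 0 < T := hT ▸ by positivity
  have hT1 : T ≤ 1 := by rw [hT, div_le_one hn]; exact htn
  have hN2 : √(C ^ 2 + T ^ 2) ^ 2 = C ^ 2 + T ^ 2 := Real.sq_sqrt (by positivity)
  have hN0 : 0 < √(C ^ 2 + T ^ 2) := Real.sqrt_pos.mpr (by positivity)
  generalize √(C ^ 2 + T ^ 2) = N at *
  have htT : t = n * T := by rw [hT]; field_simp
  have haC : a = C * L := by rw [hC]; field_simp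
  have hTN : T ≤ N := abs_le_of_sq_le_sq' (by nlinarith) hN0.le |>.2
  have hCN : C ≤ N := abs_le_of_sq_le_sq' (by nlinarith) hN0.le |>.2
  have hNle : N ≤ C + T := abs_le_of_sq_le_sq' (by nlinarith [mul_pos hC0 hT0]) (by positivity) |>.2
  obtain ⟨B, hB⟩ : ∃ B, B = C / N * Δ := ⟨_, rfl⟩
  rw [← hB] at hγ
  have hB0 : 0 < B := hB ▸ by positivity
  have hBΔ : B ≤ Δ := by
    rw [hB]; exact mul_le_of_le_one_left hΔ.le ((div_le_one hN0).mpr hCN)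
  have hBN : B * N = C * Δ := by rw [hB]; field_simp
  have hsplit : t * (Δ * (Δ + a) - (T / N * Δ) ^ 2) = t * B ^ 2 + t * Δ * a := by
    rw [hB]; field_simp; rw [hN2]; ring
  have htB : t ≤ κB := htn.trans hnB
  rw [hsplit]
  have hK1 : 0 ≤ κB * D ^ 2 / s := by positivity
  have hK2 : 0 ≤ κB * D := by positivity
  have hK3 : 0 ≤ κB * D / s := by positivity
  have hK4 : 0 ≤ κB * (κc + S) / s := by positivity
  rcases min_cases (B / y) 1 with ⟨h, h'⟩ | ⟨h, h'⟩
  · rw [h] at hγ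
    have hγa : s * B ≤ γ * a := by
      rw [hγ, div_mul_eq_mul_div, le_div_iff₀ hy]
      nlinarith [mul_le_mul_of_nonneg_left hya hB0.le]
    have h1 : t * B ^ 2 ≤ κB * D / s * (s * B) := by
      calc t * B ^ 2 = t * B * B := by ring
        _ ≤ κB * D * B := by gcongr; exact hBΔ.trans hΔD
        _ = κB * D / s * (s * B) := by field_simp
    have h2 : Δ * a ≤ B * (κc + S) := by
      calc Δ * a = B * (N * L) := by rw [haC]; linear_combination (-L) * hBN
        _ ≤ B * (κc + S) := by
          gcongr
          calc N * L ≤ (C + T) * L := by gcongr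
            _ = a + T * L := by rw [haC]; ring
            _ ≤ κc + 1 * S := by gcongr
            _ = κc + S := by ring
    have h3 : t * Δ * a ≤ κB * (κc + S) / s * (s * B) := by
      calc t * Δ * a = t * (Δ * a) := by ring
        _ ≤ κB * (B * (κc + S)) := by gcongr
        _ = κB * (κc + S) / s * (s * B) := by field_simp
    calc t * B ^ 2 + t * Δ * a
        ≤ (κB * D / s + κB * (κc + S) / s) * (s * B) := by linarith
      _ ≤ (κB * D ^ 2 / s + κB * D + κB * D / s + κB * (κc + S) / s) * (γ * a) := by
          gcongr; linarith
  · rw [h] at hγ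
    have h1 : t * B ^ 2 ≤ κB * D ^ 2 / s * a := by
      calc t * B ^ 2 = n * (T * B) * B := by rw [htT]; ring
        _ ≤ n * (C * Δ) * Δ := by
          have : T * B ≤ C * Δ := by rw [← hBN]; nlinarith
          gcongr
        _ = n * Δ ^ 2 * a / L := by rw [haC]; field_simp
        _ ≤ κB * D ^ 2 * a / s := by gcongr
        _ = κB * D ^ 2 / s * a := by ring
    have h2 : t * Δ * a ≤ κB * D * a := by gcongr
    rw [hγ, one_mul]
    linarith [mul_nonneg hK3 ha.le, mul_nonneg hK4 ha.le]

/-- Linear and quadratic model terms along a step of length `γ * y` with `y ≤ a / √k`. -/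
lemma normal_step_terms_le {k γ y a κc b Q n κB : ℝ} (hk : 0 < k) (hγ0 : 0 ≤ γ) (hγ1 : γ ≤ 1)
    (hy : 0 ≤ y) (ha : 0 ≤ a) (hac : a ≤ κc) (hya : √k * y ≤ a)
    (hb : 0 ≤ b) (hbQ : b ≤ Q) (hn : 0 ≤ n) (hnB : n ≤ κB) :
    b * (γ * y) ≤ Q / √k * (γ * a) ∧ n * (γ * y) ^ 2 ≤ κB * κc / k * (γ * a) := by
  have hs : 0 < √k := Real.sqrt_pos.mpr hk
  have hQ : 0 ≤ Q := hb.trans hbQ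
  have hκB : 0 ≤ κB := hn.trans hnB
  have hyle : y ≤ a / √k := by rw [le_div_iff₀ hs]; linarith
  constructor
  · calc b * (γ * y) ≤ Q * (γ * (a / √k)) := by gcongr
      _ = Q / √k * (γ * a) := by ring
  · calc n * (γ * y) ^ 2 ≤ κB * (γ * (a / √k)) ^ 2 := by gcongr
      _ = κB * (γ * γ * (a * a)) / √k ^ 2 := by ring
      _ ≤ κB * (1 * γ * (κc * a)) / √k ^ 2 := by gcongr
      _ = κB * κc / k * (γ * a) := by rw [Real.sq_sqrt hk.le]; ring

section Operator

variable {E F K : Type*}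
  [NormedAddCommGroup E] [InnerProductSpace ℝ E] [CompleteSpace E]
  [NormedAddCommGroup F] [InnerProductSpace ℝ F] [CompleteSpace F]
  [NormedAddCommGroup K] [InnerProductSpace ℝ K] [CompleteSpace K]

lemma inner_apply_adjoint_apply_self (G : E →L[ℝ] F) (v : F) :
    ⟪G (adjoint G v), v⟫ = ‖adjoint G v‖ ^ 2 := by
  rw [← adjoint_inner_right, real_inner_self_eq_norm_sq]

/-- The operator norm is at least the square root of the smallest eigenvalue of `G Gᵀ`. -/
lemma sqrt_le_opNorm_of_le_inner [Nontrivial F] (G : E →L[ℝ] F) {k : ℝ}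
    (h : ∀ v : F, k * ‖v‖ ^ 2 ≤ ⟪G (adjoint G v), v⟫) : √k ≤ ‖G‖ := by
  obtain ⟨v, hv⟩ := exists_norm_eq F zero_le_one
  have h1 := h v
  rw [inner_apply_adjoint_apply_self, hv] at h1
  have h2 : ‖adjoint G v‖ ≤ ‖G‖ := by
    simpa [hv] using (adjoint G).le_opNorm v
  exact Real.sqrt_le_iff.mpr ⟨norm_nonneg _, by nlinarith [norm_nonneg (adjoint G v)]⟩

/-- The operator norm is at most the square root of the largest eigenvalue of `G Gᵀ`. -/
lemma opNorm_le_sqrt_of_inner_le (G : E →L[ℝ] F) {k : ℝ} (hk : 0 ≤ k)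
    (h : ∀ v : F, ⟪G (adjoint G v), v⟫ ≤ k * ‖v‖ ^ 2) : ‖G‖ ≤ √k := by
  rw [← LinearIsometryEquiv.norm_map adjoint G]
  refine opNorm_le_bound _ (Real.sqrt_nonneg _) fun v => ?_
  have h1 := h v
  rw [inner_apply_adjoint_apply_self] at h1
  refine abs_le_of_sq_le_sq' ?_ (by positivity) |>.2
  rw [mul_pow, Real.sq_sqrt hk]
  exact h1

/-- The least-norm solution `Gᵀ (G Gᵀ)⁻¹ c` has norm at most `‖c‖ / √k`. -/
lemma sqrt_mul_norm_adjoint_le (G : E →L[ℝ] F) {k : ℝ} (hk : 0 < k)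
    (h : ∀ v : F, k * ‖v‖ ^ 2 ≤ ⟪G (adjoint G v), v⟫) {x c : F}
    (hx : G (adjoint G x) = c) : √k * ‖adjoint G x‖ ≤ ‖c‖ := by
  have h1 := h x
  have h2 := inner_apply_adjoint_apply_self G x
  have h3 := real_inner_le_norm c x
  rw [hx] at h1 h2
  refine abs_le_of_sq_le_sq' ?_ (norm_nonneg _) |>.2
  rw [mul_pow, Real.sq_sqrt hk.le, ← h2]
  have h4 : k * ‖x‖ ≤ ‖c‖ := by
    rcases (norm_nonneg x).eq_or_lt with h0 | h0
    · rw [← h0]; simp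
    · exact le_of_mul_le_mul_right (by nlinarith) h0
  nlinarith [norm_nonneg c]

lemma neg_opNorm_le_iInf_rayleigh [Nontrivial K] (H : E →L[ℝ] E) (Z : K →L[ℝ] E)
    (hZ : (adjoint Z).comp Z = ContinuousLinearMap.id ℝ _) :
    -‖H‖ ≤ ⨅ y : Metric.sphere (0 : K) 1, ⟪adjoint Z (H (Z y)), (y : K)⟫ := by
  have : Nonempty (Metric.sphere (0 : K) 1) :=
    (NormedSpace.sphere_nonempty.mpr zero_le_one).to_subtype
  refine le_ciInf fun y => ?_
  have hy : ‖(y : K)‖ = 1 := by simp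
  have hZy : ‖Z y‖ = 1 := by rw [norm_map_iff_adjoint_comp_self Z |>.mpr hZ, hy]
  rw [adjoint_inner_left]
  have h1 := abs_real_inner_le_norm (H (Z y)) (Z y)
  have h2 := H.le_opNorm (Z y)
  rw [hZy, mul_one] at h1 h2
  exact (neg_le_neg (h1.trans h2)).trans (neg_abs_le _)

/-- Expansion of the quadratic model along `w + z`, with the cross terms discarded. -/
lemma quadratic_model_add_le (H : E →L[ℝ] E) (hH : IsSelfAdjoint H) {q w z : E}
    (h : ⟪q + H w, z⟫ ≤ 0) :
    ⟪q, w + z⟫ + 1 / 2 * ⟪w + z, H (w + z)⟫ ≤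
      ‖q‖ * ‖w‖ + 1 / 2 * (‖H‖ * ‖w‖ ^ 2) + 1 / 2 * ⟪z, H z⟫ := by
  have hsymm : ⟪w, H z⟫ = ⟪H w, z⟫ := by
    have := adjoint_inner_left H z w
    rw [hH.adjoint_eq] at this
    exact this.symm
  have h1 := real_inner_le_norm q w
  have h2 := real_inner_le_norm w (H w)
  have h3 := mul_le_mul_of_nonneg_left (H.le_opNorm w) (norm_nonneg w)
  rw [inner_add_left] at h
  simp only [map_add, inner_add_left, inner_add_right, hsymm, real_inner_comm (H w) z]
  nlinarith

end Operator

/-- existence of a merit-parameter threshold `μ̃`, determined only by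
`κ_B, κ_c, κ_{∇f}, M, κ₁, κ₂, Δ_max`, beyond which the eigen step satisfies the
sufficient-reduction condition (Case 2 of Lemma 13 of the paper).  Matrices are represented
by continuous linear maps between Euclidean spaces (`Gᵀ` is the adjoint), `W` plays the role
of `(G·Gᵀ)⁻¹`, `Z` has orthonormal columns spanning `ker G`, and the smallest eigenvalue
`τ̄` of the (self-adjoint) reduced Lagrangian Hessian `Zᵀ·H̄·Z` is expressed as the infimum
of its Rayleigh quotient over the unit sphere. -/
theorem stmt_19 (κ_B κ_c κ_gradf M κ₁ κ₂ Δmax : ℝ)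
    (hκB : 0 < κ_B) (hκc : 0 < κ_c) (hκgradf : 0 < κ_gradf) (hM : 0 < M)
    (hκ₁ : 0 < κ₁) (hκ₁₂ : κ₁ ≤ κ₂) (hΔmax : 0 < Δmax) :
    ∃ μt : ℝ, 0 < μt ∧
      ∀ (κ_fcd : ℝ), 0 < κ_fcd → κ_fcd ≤ 1 →
      ∀ (d m : ℕ), 1 ≤ m → m < d →
      ∀ (cv : EuclideanSpace ℝ (Fin m))
        (G : EuclideanSpace ℝ (Fin d) →L[ℝ] EuclideanSpace ℝ (Fin m))
        (W : EuclideanSpace ℝ (Fin m) →L[ℝ] EuclideanSpace ℝ (Fin m))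
        (g gbar : EuclideanSpace ℝ (Fin d))
        (H : EuclideanSpace ℝ (Fin d) →L[ℝ] EuclideanSpace ℝ (Fin d))
        (Z : EuclideanSpace ℝ (Fin (d - m)) →L[ℝ] EuclideanSpace ℝ (Fin d))
        (Δ : ℝ) (u : EuclideanSpace ℝ (Fin (d - m))),
        ‖cv‖ ≤ κ_c →
        (∀ v : EuclideanSpace ℝ (Fin m), κ₁ * ‖v‖ ^ 2 ≤ ⟪G (adjoint G v), v⟫) →
        (∀ v : EuclideanSpace ℝ (Fin m), ⟪G (adjoint G v), v⟫ ≤ κ₂ * ‖v‖ ^ 2) →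
        (∀ v, W (G (adjoint G v)) = v) →
        (∀ v, G (adjoint G (W v)) = v) →
        ‖g‖ ≤ κ_gradf → ‖gbar - g‖ ≤ M →
        IsSelfAdjoint H →
        1 / κ_B ≤ ‖H‖ → ‖H‖ ≤ κ_B →
        (adjoint Z).comp Z = ContinuousLinearMap.id ℝ _ →
        G.comp Z = 0 →
        Z.comp (adjoint Z) = ContinuousLinearMap.id ℝ _ - (adjoint G).comp (W.comp G) →
        0 < Δ → Δ ≤ Δmax →
        let τbar : ℝ := ⨅ y : Metric.sphere (0 : EuclideanSpace ℝ (Fin (d - m))) 1,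
          ⟪adjoint Z (H (Z y)), (y : EuclideanSpace ℝ (Fin (d - m)))⟫;
        τbar < 0 →
        let τbarplus : ℝ := |min τbar 0|;
        let τbarRS : ℝ := τbarplus / ‖H‖;
        let nRS := Real.sqrt (‖cv‖ ^ 2 / ‖G‖ ^ 2 + τbarRS ^ 2);
        let Δbreve := ‖cv‖ / ‖G‖ / nRS * Δ;
        let Δtilde := τbarRS / nRS * Δ;
        let v := -(adjoint G) (W cv);
        let γ : ℝ := if v = 0 then 1 else min (Δbreve / ‖v‖) 1;
        let w := γ • v;
        ⟪gbar + H w, Z u⟫ ≤ 0 →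
        ‖u‖ ≤ Δtilde →
        ⟪Z u, H (Z u)⟫ ≤ -κ_fcd * τbarplus * Δtilde ^ 2 →
        ∀ μ : ℝ, μt ≤ μ →
        let Δx := w + Z u;
        ⟪gbar, Δx⟫ + 1 / 2 * ⟪Δx, H Δx⟫ + μ * (‖cv + G Δx‖ - ‖cv‖) ≤
          -(κ_fcd / 2) * τbarplus * Δ * (Δ + ‖cv‖) := by
  have hs : 0 < √κ₁ := Real.sqrt_pos.mpr hκ₁
  have hκ₂ : 0 < κ₂ := hκ₁.trans_le hκ₁₂
  have hS : 0 < √κ₂ := Real.sqrt_pos.mpr hκ₂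
  refine ⟨(κ_gradf + M) / √κ₁ + κ_B * κ_c / κ₁ +
    (κ_B * Δmax ^ 2 / √κ₁ + κ_B * Δmax + κ_B * Δmax / √κ₁ + κ_B * (κ_c + √κ₂) / √κ₁),
    by positivity, ?_⟩
  intro κ hκ0 hκ1 d m hm hmd c G W g q H Z Δ u hc hG1 hG2 hWG hGW hg hq hH hHl hHu hZZ hGZ _
    hΔ hΔm τ hτ t T N Δb Δt v γ w hgw _ hcurv μ hμ Δx
  have : NeZero m := ⟨by omega⟩
  have : NeZero (d - m) := ⟨by omega⟩
  have hn : 0 < ‖H‖ := lt_of_lt_of_le (by positivity) hHl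
  have htτ : t = -τ := by
    change |min τ 0| = -τ
    rw [min_eq_left hτ.le, abs_of_neg hτ]
  have ht : 0 < t := by rw [htτ]; linarith
  have htn : t ≤ ‖H‖ := by
    have : -‖H‖ ≤ τ := neg_opNorm_le_iInf_rayleigh H Z hZZ
    linarith
  have hsL := sqrt_le_opNorm_of_le_inner G hG1
  have hLS := opNorm_le_sqrt_of_inner_le G hκ₂.le hG2
  have hv : √κ₁ * ‖v‖ ≤ ‖c‖ := by
    change √κ₁ * ‖-(adjoint G) (W c)‖ ≤ ‖c‖
    rw [norm_neg]
    exact sqrt_mul_norm_adjoint_le G hκ₁ hG1 (hGW c)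
  have hGv : G v = -c := by
    change G (-(adjoint G) (W c)) = -c
    rw [map_neg, hGW]
  have hL : 0 < ‖G‖ := hs.trans_le hsL
  have hγ0 : 0 ≤ γ := by
    change 0 ≤ if v = 0 then (1 : ℝ) else min (Δb / ‖v‖) 1
    split_ifs
    · exact zero_le_one
    · positivity
  have hγ1 : γ ≤ 1 := by
    change (if v = 0 then (1 : ℝ) else min (Δb / ‖v‖) 1) ≤ 1
    split_ifs
    · exact le_rfl
    · exact min_le_right _ _
  have hqn : ‖q‖ ≤ κ_gradf + M := by
    have := norm_le_norm_add_norm_sub' q g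
    linarith
  have hGZu : G (Z u) = 0 := by simpa using congrArg (fun A => A u) hGZ
  have hfeas : ‖c + G Δx‖ - ‖c‖ = -(γ * ‖c‖) := by
    have : c + G Δx = (1 - γ) • c := by
      change c + G (γ • v + Z u) = _
      rw [map_add, map_smul, hGv, hGZu, sub_smul, one_smul, smul_neg, add_zero, sub_eq_add_neg]
    rw [this, norm_smul, Real.norm_of_nonneg (by linarith)]
    ring
  have hwn : ‖w‖ = γ * ‖v‖ := by
    change ‖γ • v‖ = _
    rw [norm_smul, Real.norm_of_nonneg hγ0]
  have hmodel := quadratic_model_add_le H hH hgw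
  obtain ⟨hlin, hquad⟩ := normal_step_terms_le hκ₁ hγ0 hγ1 (norm_nonneg v) (norm_nonneg c) hc hv
    (norm_nonneg q) hqn hn.le hHu
  rw [← hwn] at hlin hquad
  have hloss : t * (Δ * (Δ + ‖c‖) - Δt ^ 2) ≤
      (κ_B * Δmax ^ 2 / √κ₁ + κ_B * Δmax + κ_B * Δmax / √κ₁ + κ_B * (κ_c + √κ₂) / √κ₁) *
        (γ * ‖c‖) := by
    rcases eq_or_ne c 0 with h0 | h0
    · have hT : 0 < T := div_pos ht hn
      have hN : N = T := by
        change √(‖c‖ ^ 2 / ‖G‖ ^ 2 + T ^ 2) = T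
        rw [h0, norm_zero]
        simp [Real.sqrt_sq hT.le]
      have hΔt : Δt = Δ := by
        change T / N * Δ = Δ
        rw [hN, div_self hT.ne', one_mul]
      rw [hΔt, h0, norm_zero]
      apply le_of_eq
      ring
    · have hv0 : v ≠ 0 := fun h => h0 (by simpa [h] using hGv.symm)
      exact curvature_loss_le (norm_pos_iff.mpr h0) hc hs hsL hLS hn hHu ht htn hΔ hΔm
        (norm_pos_iff.mpr hv0) hv (if_neg hv0)
  have hμγ := mul_le_mul_of_nonneg_right hμ (mul_nonneg hγ0 (norm_nonneg c))
  have hκloss : κ * (t * (Δ * (Δ + ‖c‖) - Δt ^ 2)) ≤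
      (κ_B * Δmax ^ 2 / √κ₁ + κ_B * Δmax + κ_B * Δmax / √κ₁ + κ_B * (κ_c + √κ₂) / √κ₁) *
        (γ * ‖c‖) := by
    refine (mul_le_mul_of_nonneg_left hloss hκ0.le).trans (mul_le_of_le_one_left ?_ hκ1)
    positivity
  have hlossnn : 0 ≤ (κ_B * Δmax ^ 2 / √κ₁ + κ_B * Δmax + κ_B * Δmax / √κ₁ +
      κ_B * (κ_c + √κ₂) / √κ₁) * (γ * ‖c‖) := by positivity
  have hquadnn : 0 ≤ κ_B * κ_c / κ₁ * (γ * ‖c‖) := by positivity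
  rw [hfeas]
  change ⟪q, w + Z u⟫ + 1 / 2 * ⟪w + Z u, H (w + Z u)⟫ + μ * -(γ * ‖c‖) ≤ _
  linarith
end
end
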